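/- Lower bound for the Dirichlet energy of the torsion potential: let 𝒯 ∈ C²(B,ℝ^N) ∩ C⁰(B̄) solve Δ𝒯 = -δ𝒯 + 𝒮 in B with 𝒯 = 0 on ∂B, where |δ𝒯| ≤ √(n-2)|𝒯_u||𝒯_v|, 𝒮 ∈ C¹(B̄,ℝ^N). Suppose ρ ∈ (0,1) with ‖𝒮‖_{L²(B_ρ)} > 0 and ‖∇𝒮‖_{L²(B)} > 0. Then ‖∇𝒯‖²_{L²(B)} ≥ ‖𝒮‖²_{L²(B_ρ)} / [2(√(n-2)‖𝒮‖_{L^∞(B)} + ‖𝒮‖²_{L²(B)}/((1-ρ)²‖𝒮‖²_{L²(B_ρ)}) + 2‖∇𝒮‖²_{L²(B)}/‖𝒮‖²_{L²(B_ρ)})] > 0. -/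

import Mathlib

open MeasureTheory

lemma aux_sq_deriv (t : ℝ) : HasDerivAt (fun t : ℝ => (max t 0) ^ 2) (2 * max t 0) t := by
  refine hasDerivAt_of_hasDerivAt_of_ne' (x := 0) (f := fun t : ℝ => (max t 0) ^ 2)
    (g := fun t : ℝ => 2 * max t 0) ?_ ?_ ?_ t
  · intro y hy
    rcases lt_or_gt_of_ne hy with h | h
    · have h1 : HasDerivAt (fun _ : ℝ => (0:ℝ)) 0 y := hasDerivAt_const _ _
      rw [max_eq_right h.le, mul_zero]
      refine h1.congr_of_eventuallyEq ?_
      filter_upwards [gt_mem_nhds h] with z hz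
      simp [max_eq_right (le_of_lt hz)]
    · have h1 : HasDerivAt (fun z : ℝ => z ^ 2) (2 * y) y := by
        simpa using hasDerivAt_pow 2 y
      rw [max_eq_left h.le]
      refine h1.congr_of_eventuallyEq ?_
      filter_upwards [lt_mem_nhds h] with z hz
      simp [max_eq_left (le_of_lt hz)]
  · fun_prop
  · fun_prop

/-- one dimensional cutoff: -/
lemma aux_h : ∃ h : ℝ → ℝ, ContDiff ℝ 1 h ∧ (∀ s ≤ 0, h s = 1) ∧ (∀ s, 19/20 ≤ s → h s = 0) ∧
    (∀ s, 0 ≤ h s ∧ h s ≤ 1) ∧ (∀ s, (deriv h s)^2 ≤ 3/2) := by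
  set P : ℝ → ℝ := fun t => (max t 0) ^ 2 with hP
  set h : ℝ → ℝ := fun s => 1 - (100/9) * (P s - P (s - 1/20) - P (s - 9/10) + P (s - 19/20)) with hh
  have hder : ∀ s, HasDerivAt h (-((100/9) * (2 * max s 0 - 2 * max (s-1/20) 0
      - 2 * max (s-9/10) 0 + 2 * max (s-19/20) 0))) s := by
    intro s
    have a := fun c : ℝ => (aux_sq_deriv (s - c)).comp_sub_const s c
    have := ((((aux_sq_deriv s).sub (a (1/20))).sub (a (9/10))).add (a (19/20))).const_mul (100/9:ℝ)
    exact this.const_sub 1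
  have hd : deriv h = fun s => -((100/9) * (2 * max s 0 - 2 * max (s-1/20) 0
      - 2 * max (s-9/10) 0 + 2 * max (s-19/20) 0)) := funext fun s => (hder s).deriv
  have hdn : ∀ s, -(10/9) ≤ deriv h s ∧ deriv h s ≤ 0 := by
    intro s
    rw [hd]
    rcases max_cases s 0 with ⟨e1, _⟩ | ⟨e1, _⟩ <;>
    rcases max_cases (s-1/20) 0 with ⟨e2, _⟩ | ⟨e2, _⟩ <;>
    rcases max_cases (s-9/10) 0 with ⟨e3, _⟩ | ⟨e3, _⟩ <;>
    rcases max_cases (s-19/20) 0 with ⟨e4, _⟩ | ⟨e4, _⟩ <;>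
    simp only [e1, e2, e3, e4] <;> constructor <;> linarith
  have h1 : ∀ s ≤ 0, h s = 1 := by
    intro s hs
    simp only [hh, hP]
    rw [max_eq_right hs, max_eq_right (by linarith), max_eq_right (by linarith),
      max_eq_right (by linarith)]
    norm_num
  have h2 : ∀ s, 19/20 ≤ s → h s = 0 := by
    intro s hs
    simp only [hh, hP]
    rw [max_eq_left (by linarith), max_eq_left (by linarith), max_eq_left (by linarith),
      max_eq_left (by linarith)]
    ring
  have hanti : Antitone h := antitone_of_deriv_nonpos (fun s => (hder s).differentiableAt)
    fun s => (hdn s).2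
  refine ⟨h, ?_, h1, h2, ?_, ?_⟩
  · rw [contDiff_one_iff_deriv]
    refine ⟨fun s => (hder s).differentiableAt, ?_⟩
    rw [hd]; fun_prop
  · intro s
    constructor
    · rw [← h2 (max s (19/20)) (le_max_right _ _)]
      exact hanti (le_max_left _ _)
    · rw [← h1 (min s 0) (min_le_right _ _)]
      exact hanti (min_le_left _ _)
  · intro s
    nlinarith [hdn s]

lemma aux_cutoff (ρ : ℝ) (hρ0 : 0 < ρ) (hρ1 : ρ < 1) : ∃ η : ℝ × ℝ → ℝ, ∃ r : ℝ, ContDiff ℝ 1 η ∧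
    r < 1 ∧ 0 < r ∧
    (∀ p : ℝ × ℝ, p.1^2+p.2^2 < ρ^2 → η p = 1) ∧ (∀ p : ℝ × ℝ, r^2 < p.1^2+p.2^2 → η p = 0) ∧
    (∀ p, 0 ≤ η p ∧ η p ≤ 1) ∧
    (∀ p, (fderiv ℝ η p (1,0))^2 + (fderiv ℝ η p (0,1))^2 ≤ (3/2) / (1-ρ)^2) := by
  obtain ⟨h, hc, h1, h2, h01, hd⟩ := aux_h
  have hr : 0 < 1 - ρ := by linarith
  set k : ℝ → ℝ := fun t => h ((t - ρ) / (1-ρ)) with hk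
  have hkc : ContDiff ℝ 1 k := hc.comp (by fun_prop)
  have hk1 : ∀ t ≤ ρ, k t = 1 := fun t ht => h1 _ (div_nonpos_of_nonpos_of_nonneg (by linarith) hr.le)
  have hkd : ∀ t, (deriv k t)^2 ≤ (3/2)/(1-ρ)^2 := by
    intro t
    have : HasDerivAt k (deriv h ((t - ρ) / (1-ρ)) * (1/(1-ρ))) t := by
      have e : HasDerivAt (fun t : ℝ => (t - ρ)/(1-ρ)) (1/(1-ρ)) t :=
        ((hasDerivAt_id t).sub_const ρ).div_const _
      exact HasDerivAt.comp t ((hc.differentiable (by norm_num)) _).hasDerivAt e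
    rw [this.deriv, mul_pow, div_pow, one_pow, mul_one_div]
    gcongr
    exact hd _
  set η : ℝ × ℝ → ℝ := fun p => k (√(p.1^2+p.2^2)) with hη
  have hη1 : ∀ p : ℝ × ℝ, p.1^2+p.2^2 < ρ^2 → η p = 1 := fun p hp =>
    hk1 _ (by rw [Real.sqrt_le_left hρ0.le]; exact hp.le)
  have hloc : ∀ p : ℝ × ℝ, p.1^2+p.2^2 < ρ^2 → η =ᶠ[nhds p] fun _ => 1 := by
    intro p hp
    have : IsOpen {p : ℝ × ℝ | p.1^2+p.2^2 < ρ^2} := isOpen_lt (by fun_prop) (by fun_prop)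
    filter_upwards [this.mem_nhds hp] with q hq using hη1 q hq
  refine ⟨η, ρ + 19/20*(1-ρ), ?_, by linarith, by linarith, hη1, ?_, fun p => h01 _, ?_⟩
  · rw [contDiff_iff_contDiffAt]
    intro p
    by_cases hp : p.1^2+p.2^2 < ρ^2
    · exact contDiffAt_const.congr_of_eventuallyEq (hloc p hp)
    · have hne : p.1^2+p.2^2 ≠ 0 := by nlinarith
      have : ContDiffAt ℝ 1 (fun p : ℝ × ℝ => √(p.1^2+p.2^2)) p :=
        ContDiffAt.sqrt (by fun_prop) hne
      exact hkc.contDiffAt.comp p this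
  · intro p hp
    refine h2 _ ?_
    rw [le_div_iff₀ hr]
    have := Real.lt_sqrt_of_sq_lt hp
    linarith
  · intro p
    by_cases hp : p.1^2+p.2^2 < ρ^2
    · rw [(hloc p hp).fderiv_eq]
      simp
      positivity
    · have hpos : 0 < p.1^2+p.2^2 := by nlinarith
      have hq : HasFDerivAt (fun p : ℝ × ℝ => p.1^2+p.2^2) ((2*p.1) • ContinuousLinearMap.fst ℝ ℝ ℝ
          + (2*p.2) • ContinuousLinearMap.snd ℝ ℝ ℝ) p := by
        have a := (hasFDerivAt_fst (𝕜 := ℝ) (p := p)).pow 2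
        have b := (hasFDerivAt_snd (𝕜 := ℝ) (p := p)).pow 2
        have c := a.fun_add b
        simpa using c
      have hs := hq.sqrt hpos.ne'
      have hkk := ((hkc.differentiable (by norm_num)) (√(p.1^2+p.2^2))).hasDerivAt
      have := hkk.comp_hasFDerivAt p hs
      have e : fderiv ℝ η p = _ := this.fderiv
      rw [e]
      have hs2 := Real.sq_sqrt hpos.le
      have hs0 := Real.sqrt_pos.2 hpos
      refine le_trans (le_of_eq ?_) (hkd (√(p.1^2+p.2^2)))
      simp
      set s := √(p.1^2+p.2^2)
      have : deriv k s ^ 2 * (p.1^2+p.2^2) / s^2 = deriv k s ^2 := by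
        rw [← hs2]; field_simp
      rw [← this]
      field_simp

/-- divergence lemma -/
lemma aux_div {B : Set (ℝ × ℝ)} (hB : IsOpen B) (f : ℝ × ℝ → ℝ) (hf : ContDiffOn ℝ 1 f B)
    (K : Set (ℝ × ℝ)) (hK : IsCompact K) (hKB : K ⊆ B) (h0 : ∀ w ∈ B, w ∉ K → f w = 0) (v : ℝ × ℝ) :
    IntegrableOn (fun w => fderiv ℝ f w v) B ∧ ∫ w in B, fderiv ℝ f w v = 0 := by
  set g : ℝ × ℝ → ℝ := B.indicator f with hg
  have hgz : ∀ w, w ∉ K → g w = 0 := by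
    intro w hw
    by_cases hb : w ∈ B
    · simp [hg, hb, h0 w hb hw]
    · simp [hg, hb]
  have hgf : ∀ w ∈ B, g =ᶠ[nhds w] f := by
    intro w hw
    filter_upwards [hB.mem_nhds hw] with z hz
    simp [hg, hz]
  have hgc : ContDiff ℝ 1 g := by
    rw [contDiff_iff_contDiffAt]
    intro w
    by_cases hw : w ∈ K
    · exact ((hf.contDiffAt (hB.mem_nhds (hKB hw)))).congr_of_eventuallyEq (hgf w (hKB hw))
    · have : g =ᶠ[nhds w] fun _ => 0 := by
        filter_upwards [hK.isClosed.isOpen_compl.mem_nhds hw] with z hz using hgz z hz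
      exact contDiffAt_const.congr_of_eventuallyEq this
  have hsupp : HasCompactSupport g := HasCompactSupport.intro hK hgz
  have hcont : Continuous (fun w => fderiv ℝ g w v) :=
    (hgc.continuous_fderiv (by norm_num)).clm_apply continuous_const
  have hint : Integrable (fun w => fderiv ℝ g w v) :=
    hcont.integrable_of_hasCompactSupport (hsupp.fderiv_apply (𝕜 := ℝ) v)
  have hzero : ∫ w, fderiv ℝ g w v = 0 := by
    have := integral_mul_fderiv_eq_neg_fderiv_mul_of_integrable (μ := volume) (𝕜 := ℝ)
      (f := fun _ : ℝ × ℝ => (1:ℝ)) (g := g) (v := v) (by simp) (by simpa using hint)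
      (by simpa using hgc.continuous.integrable_of_hasCompactSupport hsupp)
      (fun x _ => by fun_prop) (fun x _ => hgc.differentiable (by norm_num) x)
    simpa using this
  have heq : ∀ w ∈ B, fderiv ℝ g w v = fderiv ℝ f w v := fun w hw => by rw [(hgf w hw).fderiv_eq]
  constructor
  · exact (hint.integrableOn (s := B)).congr_fun heq hB.measurableSet
  · rw [← setIntegral_congr_fun hB.measurableSet heq, setIntegral_eq_integral_of_forall_compl_eq_zero,
      hzero]
    intro w hw
    have : g =ᶠ[nhds w] fun _ => 0 := by
      filter_upwards [hK.isClosed.isOpen_compl.mem_nhds (fun h => hw (hKB h))] with z hz using hgz z hz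
    rw [this.fderiv_eq]; simp

section
variable {E : Type*} [NormedAddCommGroup E] [InnerProductSpace ℝ E]

lemma aux_pt (T : ℝ × ℝ → E) (w v : ℝ × ℝ) (hT : ContDiffAt ℝ 2 T w) (ψ : ℝ → ℝ)
    (hψ : Differentiable ℝ ψ) :
    fderiv ℝ (fun p => ψ (inner ℝ (T p) (T p) + (1 - p.1^2 - p.2^2)) *
      (inner ℝ (T p) (fderiv ℝ T p v) - (p.1 * v.1 + p.2 * v.2))) w v
    = deriv ψ (inner ℝ (T w) (T w) + (1 - w.1^2 - w.2^2)) *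
        (2 * (inner ℝ (T w) (fderiv ℝ T w v) - (w.1 * v.1 + w.2 * v.2)) ^ 2)
      + ψ (inner ℝ (T w) (T w) + (1 - w.1^2 - w.2^2)) *
        (inner ℝ (T w) (fderiv ℝ (fun p => fderiv ℝ T p v) w v) + ‖fderiv ℝ T w v‖^2
          - (v.1^2+v.2^2)) := by
  have hTd : DifferentiableAt ℝ T w := hT.differentiableAt (by norm_num)
  have hU : DifferentiableAt ℝ (fun p => fderiv ℝ T p v) w := by
    have : ContDiffAt ℝ 1 (fderiv ℝ T) w := hT.fderiv_right (by norm_num)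
    exact (this.differentiableAt (by norm_num)).clm_apply (differentiableAt_const v)
  have hx : HasFDerivAt (fun p : ℝ × ℝ => p.1) (ContinuousLinearMap.fst ℝ ℝ ℝ) w := hasFDerivAt_fst
  have hy : HasFDerivAt (fun p : ℝ × ℝ => p.2) (ContinuousLinearMap.snd ℝ ℝ ℝ) w := hasFDerivAt_snd
  have hg := (hTd.hasFDerivAt.inner ℝ hTd.hasFDerivAt).fun_add
    (((hx.pow 2).const_sub 1).fun_sub (hy.pow 2))
  have hψg := ((hψ (inner ℝ (T w) (T w) + (1 - w.1^2 - w.2^2))).hasDerivAt).comp_hasFDerivAt w hg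
  have hr := (hTd.hasFDerivAt.inner ℝ hU.hasFDerivAt).fun_sub
    ((hx.mul_const v.1).fun_add (hy.mul_const v.2))
  have hm := (hψg.fun_mul hr).fderiv
  have := congrArg (fun F => F v) hm
  refine Eq.trans this ?_
  simp [real_inner_comm (T w), fderivInnerCLM_apply]
  rw [real_inner_comm (fderiv ℝ T w v) (T w)]
  ring

lemma aux_int (L : ℝ) (hL : 0 ≤ L) (B : Set (ℝ × ℝ))
    (hB : B = {p : ℝ × ℝ | p.1 ^ 2 + p.2 ^ 2 < 1}) (T δ S : ℝ × ℝ → E)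
    (hT : ContDiffOn ℝ 2 T B) (hTc : ContinuousOn T (closure B)) (hS : ContinuousOn S (closure B))
    (hpde : ∀ w ∈ B,
      fderiv ℝ (fun p => fderiv ℝ T p (1, 0)) w (1, 0)
        + fderiv ℝ (fun p => fderiv ℝ T p (0, 1)) w (0, 1)
      = -δ w + S w)
    (hbd : ∀ w : ℝ × ℝ, w.1 ^ 2 + w.2 ^ 2 = 1 → T w = 0)
    (hδ : ∀ w ∈ B, ‖δ w‖ ≤ L * (‖fderiv ℝ T w (1, 0)‖ * ‖fderiv ℝ T w (0, 1)‖)) :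
    IntegrableOn (fun w => ‖fderiv ℝ T w (1, 0)‖ ^ 2 + ‖fderiv ℝ T w (0, 1)‖ ^ 2) B := by
  have hBo : IsOpen B := by rw [hB]; exact isOpen_lt (by fun_prop) (by fun_prop)
  have hcl : ∀ w ∈ closure B, w.1^2 + w.2^2 ≤ 1 := by
    have : closure B ⊆ {p : ℝ × ℝ | p.1 ^ 2 + p.2 ^ 2 ≤ 1} :=
      closure_minimal (by rw [hB]; intro p hp; have hp : p.1^2+p.2^2 < 1 := hp; exact hp.le)
        (isClosed_le (by fun_prop) (by fun_prop))
    exact fun w hw => this hw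
  have hcl2 : ∀ w ∈ closure B, w ∉ B → w.1^2+w.2^2 = 1 := by
    intro w hw hwB
    rw [hB] at hwB
    exact le_antisymm (hcl w hw) (not_lt.1 hwB)
  have hbdd : Bornology.IsBounded (closure B) := by
    refine (Metric.isBounded_closedBall (x := (0 : ℝ × ℝ)) (r := 1)).subset ?_
    intro w hw
    have := hcl w hw
    rw [mem_closedBall_zero_iff, Prod.norm_def]
    refine max_le ?_ ?_ <;> rw [Real.norm_eq_abs, abs_le] <;> constructor <;> nlinarith
  have hcomp : IsCompact (closure B) := Metric.isCompact_of_isClosed_isBounded isClosed_closure hbdd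
  have hfin : volume B ≠ ⊤ := ((measure_mono subset_closure).trans_lt hcomp.measure_lt_top).ne
  have hDc : ContDiffOn ℝ 1 (fderiv ℝ T) B := hT.fderiv_of_isOpen hBo (by norm_num)
  have hUc : ∀ v : ℝ × ℝ, ContDiffOn ℝ 1 (fun p => fderiv ℝ T p v) B := fun v =>
    hDc.clm_apply contDiffOn_const
  set e : ℝ × ℝ → ℝ := fun w => ‖fderiv ℝ T w (1, 0)‖ ^ 2 + ‖fderiv ℝ T w (0, 1)‖ ^ 2 with he
  have hec : ContinuousOn e B := ((hUc _).continuousOn.norm.pow 2).add ((hUc _).continuousOn.norm.pow 2)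
  have he0 : ∀ w, 0 ≤ e w := fun w => by positivity
  obtain ⟨CT, hCT⟩ := hcomp.exists_bound_of_continuousOn hTc
  obtain ⟨CS, hCS⟩ := hcomp.exists_bound_of_continuousOn hS
  obtain ⟨D, hD0, hD⟩ : ∃ D, 0 ≤ D ∧ ∀ w ∈ B, ‖T w‖ * L * e w ≤ e w + D := by
    set K0 : Set (ℝ × ℝ) := closure B ∩ {w | 1 ≤ L * ‖T w‖} with hK0
    have hK0c : IsCompact K0 := by
      refine hcomp.of_isClosed_subset ?_ Set.inter_subset_left
      exact (continuousOn_const.mul hTc.norm).preimage_isClosed_of_isClosed isClosed_closure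
        (isClosed_Ici (a := (1:ℝ)))
    have hK0B : K0 ⊆ B := by
      rintro w ⟨hw, h1⟩
      by_contra hwB
      have := hbd w (hcl2 w hw hwB)
      simp [this] at h1
      linarith
    obtain ⟨D, hD⟩ := hK0c.exists_bound_of_continuousOn (f := fun w => ‖T w‖ * L * e w)
      (((hT.continuousOn.norm.mul continuousOn_const).mul hec).mono hK0B)
    refine ⟨|D|, abs_nonneg _, fun w hw => ?_⟩
    by_cases h : 1 ≤ L * ‖T w‖
    · have := hD w ⟨subset_closure hw, h⟩
      have := (le_abs_self _).trans this
      linarith [he0 w, le_abs_self D]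
    · push Not at h
      have := mul_le_mul_of_nonneg_right h.le (he0 w)
      linarith [abs_nonneg D, mul_comm L ‖T w‖]
  set C : ℝ := D / 2 + CT * CS + 2 with hC
  set g : ℝ × ℝ → ℝ := fun p => inner ℝ (T p) (T p) + (1 - p.1^2 - p.2^2) with hg
  have hgc : ContinuousOn g (closure B) := (hTc.inner hTc).add (by fun_prop)
  have hgB : ∀ w ∈ B, 0 < g w := by
    intro w hw
    rw [hB] at hw
    have : 0 ≤ inner ℝ (T w) (T w) := real_inner_self_nonneg
    have hw : w.1^2+w.2^2 < 1 := hw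
    simp only [hg]; linarith
  -- main estimate
  have hmain : ∀ ε : ℝ, 0 < ε → ∫⁻ w in B ∩ {w | 2 * ε ≤ g w}, ENNReal.ofReal (e w)
      ≤ ENNReal.ofReal (2 * C * volume.real B) := by
    intro ε hε
    set ψ : ℝ → ℝ := fun t => Real.smoothTransition ((t - ε)/ε) with hψ
    have hψc : ContDiff ℝ 1 ψ := Real.smoothTransition.contDiff.comp (by fun_prop)
    have hψd : Differentiable ℝ ψ := hψc.differentiable (by norm_num)
    have hψmono : Monotone ψ := by
      intro a b hab
      refine Real.smoothTransition.monotone ?_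
      gcongr
    have hψ' : ∀ t, 0 ≤ deriv ψ t := fun t => hψmono.deriv_nonneg
    have hψ0 : ∀ t, 0 ≤ ψ t := fun t => Real.smoothTransition.nonneg _
    have hψ1 : ∀ t, ψ t ≤ 1 := fun t => Real.smoothTransition.le_one _
    have hψz : ∀ t ≤ ε, ψ t = 0 := fun t ht =>
      Real.smoothTransition.zero_of_nonpos (div_nonpos_of_nonpos_of_nonneg (by linarith) hε.le)
    have hψo : ∀ t, 2 * ε ≤ t → ψ t = 1 := fun t ht =>
      Real.smoothTransition.one_of_one_le (by rw [le_div_iff₀ hε]; linarith)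
    set K : Set (ℝ × ℝ) := closure B ∩ {w | ε ≤ g w} with hK
    have hKc : IsCompact K := by
      refine hcomp.of_isClosed_subset ?_ Set.inter_subset_left
      exact hgc.preimage_isClosed_of_isClosed isClosed_closure (isClosed_Ici (a := ε))
    have hKB : K ⊆ B := by
      rintro w ⟨hw, h1⟩
      by_contra hwB
      have h2 := hcl2 w hw hwB
      have := hbd w h2
      have h1 : ε ≤ g w := h1
      simp only [hg, this, inner_zero_left] at h1
      linarith
    set F : ℝ × ℝ → ℝ × ℝ → ℝ := fun v p => ψ (g p) *
      (inner ℝ (T p) (fderiv ℝ T p v) - (p.1 * v.1 + p.2 * v.2)) with hF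
    have hTc1 : ContDiffOn ℝ 1 T B := hT.of_le (by norm_num)
    have hFc : ∀ v, ContDiffOn ℝ 1 (F v) B := by
      intro v
      refine ContDiffOn.mul ?_ ?_
      · refine hψc.comp_contDiffOn ?_
        exact (hTc1.inner ℝ hTc1).add (by fun_prop)
      · exact (hTc1.inner ℝ (hUc v)).sub (by fun_prop)
    have hFz : ∀ v, ∀ w ∈ B, w ∉ K → F v w = 0 := by
      intro v w hw hwK
      have : g w ≤ ε := by
        by_contra h
        exact hwK ⟨subset_closure hw, (not_le.1 h).le⟩
      simp [hF, hψz _ this]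
    obtain ⟨i1, z1⟩ := aux_div hBo (F (1,0)) (hFc _) K hKc hKB (hFz _) (1,0)
    obtain ⟨i2, z2⟩ := aux_div hBo (F (0,1)) (hFc _) K hKc hKB (hFz _) (0,1)
    set G : ℝ × ℝ → ℝ := fun w => 2 * (fderiv ℝ (F (1,0)) w (1,0) + fderiv ℝ (F (0,1)) w (0,1) + C)
      with hG
    have hGi : IntegrableOn G B := ((i1.add i2).add (integrableOn_const hfin)).const_mul 2
    have hGe : ∀ w ∈ B, ψ (g w) * e w ≤ G w := by
      intro w hw
      have hTa : ContDiffAt ℝ 2 T w := hT.contDiffAt (hBo.mem_nhds hw)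
      have p1 : fderiv ℝ (F (1,0)) w (1,0) = _ := aux_pt T w (1,0) hTa ψ hψd
      have p2 : fderiv ℝ (F (0,1)) w (0,1) = _ := aux_pt T w (0,1) hTa ψ hψd
      have hsum : inner ℝ (T w) (fderiv ℝ (fun p => fderiv ℝ T p (1, 0)) w (1, 0))
        + inner ℝ (T w) (fderiv ℝ (fun p => fderiv ℝ T p (0, 1)) w (0, 1))
        = inner ℝ (T w) (-δ w + S w) := by rw [← inner_add_right, hpde w hw]
      have hge : -(‖T w‖ * L * e w / 2 + CT * CS) ≤ inner ℝ (T w) (-δ w + S w) := by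
        rw [inner_add_right, inner_neg_right]
        have a1 := real_inner_le_norm (T w) (δ w)
        have a2 := neg_le_of_abs_le (abs_real_inner_le_norm (T w) (S w))
        have a3 : ‖T w‖ * ‖S w‖ ≤ CT * CS := mul_le_mul (hCT w (subset_closure hw))
          (hCS w (subset_closure hw)) (norm_nonneg _) ((norm_nonneg _).trans (hCT w (subset_closure hw)))
        have a4 : ‖T w‖ * ‖δ w‖ ≤ ‖T w‖ * (L * (e w / 2)) := by
          refine mul_le_mul_of_nonneg_left ((hδ w hw).trans ?_) (norm_nonneg _)
          refine mul_le_mul_of_nonneg_left ?_ hL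
          simp only [he]
          nlinarith [sq_nonneg (‖fderiv ℝ T w (1, 0)‖ - ‖fderiv ℝ T w (0, 1)‖)]
        linarith
      have hDw := hD w hw
      have q1 := mul_nonneg (hψ' (g w)) (by positivity :
        0 ≤ 2 * (inner ℝ (T w) (fderiv ℝ T w (1,0)) - (w.1 * (1:ℝ) + w.2 * (0:ℝ))) ^ 2)
      have q2 := mul_nonneg (hψ' (g w)) (by positivity :
        0 ≤ 2 * (inner ℝ (T w) (fderiv ℝ T w (0,1)) - (w.1 * (0:ℝ) + w.2 * (1:ℝ))) ^ 2)
      have hCn : 0 ≤ C := by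
        have := mul_nonneg ((norm_nonneg _).trans (hCT w (subset_closure hw)))
          ((norm_nonneg _).trans (hCS w (subset_closure hw)))
        simp only [hC]; linarith
      have q3 : 0 ≤ ψ (g w) * (inner ℝ (T w) (-δ w + S w) + e w - 2 - (e w / 2 - C)) := by
        refine mul_nonneg (hψ0 _) ?_
        simp only [hC]
        linarith
      have q4 : ψ (g w) * C ≤ C := mul_le_of_le_one_left hCn (hψ1 _)
      rw [← hsum] at q3
      simp only [hG, p1, p2]
      simp only [he] at q3 ⊢
      have eg : inner ℝ (T w) (T w) + (1 - w.1^2 - w.2^2) = g w := rfl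
      rw [eg]
      nlinarith
    have hGn : ∀ w ∈ B, 0 ≤ G w := fun w hw => (mul_nonneg (hψ0 _) (he0 w)).trans (hGe w hw)
    have hmeas : MeasurableSet (B ∩ {w | 2 * ε ≤ g w}) := by
      have : B ∩ {w | 2 * ε ≤ g w} = B ∩ (closure B ∩ {w | 2 * ε ≤ g w}) := by
        rw [← Set.inter_assoc, Set.inter_eq_left.2 (subset_closure (s := B))]
      rw [this]
      exact hBo.measurableSet.inter
        (hgc.preimage_isClosed_of_isClosed isClosed_closure (isClosed_Ici (a := 2*ε))).measurableSet
    calc ∫⁻ w in B ∩ {w | 2 * ε ≤ g w}, ENNReal.ofReal (e w)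
        ≤ ∫⁻ w in B ∩ {w | 2 * ε ≤ g w}, ENNReal.ofReal (G w) := by
          refine setLIntegral_mono' hmeas ?_
          rintro w ⟨hw, hgw⟩
          refine ENNReal.ofReal_le_ofReal ?_
          have := hGe w hw
          rwa [hψo _ hgw, one_mul] at this
      _ ≤ ∫⁻ w in B, ENNReal.ofReal (G w) := lintegral_mono_set Set.inter_subset_left
      _ = ENNReal.ofReal (∫ w in B, G w) := by
          rw [ofReal_integral_eq_lintegral_ofReal hGi]
          exact ae_restrict_of_forall_mem hBo.measurableSet hGn
      _ = ENNReal.ofReal (2 * C * volume.real B) := by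
          congr 1
          simp only [hG]
          have hsplit : IntegrableOn (fun w => fderiv ℝ (F (1,0)) w (1,0)
            + fderiv ℝ (F (0,1)) w (0,1)) B := i1.add i2
          rw [integral_const_mul, integral_add hsplit (integrableOn_const hfin),
            integral_add i1 i2, z1, z2, setIntegral_const, smul_eq_mul]
          ring
  have hU : B = ⋃ k : ℕ, B ∩ {w | 2 * (1 / ((k:ℝ)+1)) ≤ g w} := by
    ext w
    simp only [Set.mem_iUnion, Set.mem_inter_iff, Set.mem_ofPred_eq]
    constructor
    · intro hw
      obtain ⟨k, hk⟩ := exists_nat_one_div_lt (half_pos (hgB w hw))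
      exact ⟨k, hw, by linarith⟩
    · rintro ⟨k, hw, _⟩; exact hw
  have hdir : Directed (· ⊆ ·) (fun k : ℕ => B ∩ {w | 2 * (1 / ((k:ℝ)+1)) ≤ g w}) := by
    refine Monotone.directed_le ?_
    intro i j hij w hw
    have h2 : 2 * (1 / ((i:ℝ)+1)) ≤ g w := hw.2
    refine ⟨hw.1, ?_⟩
    change 2 * (1 / ((j:ℝ)+1)) ≤ g w
    have := Nat.one_div_le_one_div (α := ℝ) hij
    linarith
  have hlin : ∫⁻ w in B, ENNReal.ofReal (e w) ≤ ENNReal.ofReal (2 * C * volume.real B) := by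
    rw [hU, setLIntegral_iUnion_of_directed _ hdir, ← hU]
    exact iSup_le fun k => hmain _ (by positivity)
  refine ⟨hec.aestronglyMeasurable hBo.measurableSet, ?_⟩
  rw [hasFiniteIntegral_iff_ofReal (Filter.Eventually.of_forall he0)]
  exact hlin.trans_lt ENNReal.ofReal_lt_top

end

lemma aux_young (a b t : ℝ) (ht : 0 < t) : a * b ≤ t * a ^ 2 + b ^ 2 / (4 * t) := by
  have : t * a ^ 2 + b ^ 2 / (4 * t) - a * b = (2 * t * a - b) ^ 2 / (4 * t) := by
    field_simp; ring
  have h2 : 0 ≤ (2 * t * a - b) ^ 2 / (4 * t) := by positivity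
  linarith

lemma aux_final (a b c X m κ : ℝ) (ha : 0 < a) (hab : a ≤ b) (hc : 0 < c) (hX : 0 ≤ X) (hm : 0 ≤ m)
    (hκ : 0 < κ)
    (h : ∀ θ θ' : ℝ, 0 < θ → 0 < θ' →
      a ≤ θ * b + (3/2) / κ^2 * X / (4 * θ) + θ' * c + X / (4 * θ') + m * X / 2) :
    X ≥ a / (2 * (m + b / (κ^2 * a) + 2 * c / a)) ∧
    0 < a / (2 * (m + b / (κ^2 * a) + 2 * c / a)) := by
  have hb : 0 < b := ha.trans_le hab
  have hden : 0 < 2 * (m + b / (κ^2 * a) + 2 * c / a) := by positivity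
  refine ⟨?_, by positivity⟩
  rw [ge_iff_le, div_le_iff₀ hden]
  have := h (3 * a / (8 * b)) (a / (8 * c)) (by positivity) (by positivity)
  have e1 : 3 * a / (8 * b) * b = 3 * a / 8 := by field_simp
  have e2 : (3/2) / κ^2 * X / (4 * (3 * a / (8 * b))) = X * (b / (κ^2 * a)) := by
    field_simp; ring
  have e3 : a / (8 * c) * c = a / 8 := by field_simp
  have e4 : X / (4 * (a / (8 * c))) = X * (2 * c / a) := by field_simp; ring
  rw [e1, e2, e3, e4] at this
  have : 0 ≤ m * X := by positivity
  linarith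

section
variable {E : Type*} [NormedAddCommGroup E] [InnerProductSpace ℝ E]

lemma aux_pt2 (S U : ℝ × ℝ → E) (η : ℝ × ℝ → ℝ) (w v : ℝ × ℝ) (hS : DifferentiableAt ℝ S w)
    (hU : DifferentiableAt ℝ U w) (hη : DifferentiableAt ℝ η w) :
    fderiv ℝ (fun p => η p * inner ℝ (S p) (U p)) w v =
      fderiv ℝ η w v * inner ℝ (S w) (U w) + η w * inner ℝ (fderiv ℝ S w v) (U w)
        + η w * inner ℝ (S w) (fderiv ℝ U w v) := by
  have hm := (hη.hasFDerivAt.fun_mul (hS.hasFDerivAt.inner ℝ hU.hasFDerivAt)).fderiv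
  refine Eq.trans (congrArg (fun F => F v) hm) ?_
  simp [fderivInnerCLM_apply]
  ring

lemma aux_alg (L M θ θ' k h hu hv : ℝ) (S Su Sv U V d lap1 lap2 : E) (hL : 0 ≤ L)
    (hθ : 0 < θ) (hθ' : 0 < θ') (hh0 : 0 ≤ h) (hh1 : h ≤ 1) (hk : hu^2+hv^2 ≤ k) (hM : ‖S‖ ≤ M)
    (hd : ‖d‖ ≤ L * (‖U‖ * ‖V‖)) (hl : lap1 + lap2 = -d + S) :
    h * ‖S‖^2 ≤ (hu * inner ℝ S U + h * inner ℝ Su U + h * inner ℝ S lap1)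
      + (hv * inner ℝ S V + h * inner ℝ Sv V + h * inner ℝ S lap2)
      + (θ * ‖S‖^2 + k / (4 * θ) * (‖U‖^2+‖V‖^2) + θ' * (‖Su‖^2+‖Sv‖^2)
        + 1 / (4 * θ') * (‖U‖^2+‖V‖^2) + L * M / 2 * (‖U‖^2+‖V‖^2)) := by
  have hs : inner ℝ S lap1 + inner ℝ S lap2 = - inner ℝ S d + ‖S‖^2 := by
    rw [← inner_add_right, hl, inner_add_right, inner_neg_right, real_inner_self_eq_norm_sq]
  have a1 : h * inner ℝ S d ≤ L * M / 2 * (‖U‖^2+‖V‖^2) := by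
    have h1 : inner ℝ S d ≤ M * (L * (‖U‖ * ‖V‖)) :=
      (real_inner_le_norm S d).trans (mul_le_mul hM hd (norm_nonneg _) ((norm_nonneg _).trans hM))
    have hM0 : 0 ≤ M := (norm_nonneg _).trans hM
    have h2 : h * inner ℝ S d ≤ 1 * (M * (L * (‖U‖ * ‖V‖))) := by
      refine (mul_le_mul_of_nonneg_left h1 hh0).trans ?_
      exact mul_le_mul_of_nonneg_right hh1 (by positivity)
    have h3 := mul_nonneg (mul_nonneg hL hM0) (sq_nonneg (‖U‖ - ‖V‖))
    nlinarith
  have a2 : ∀ P Q : E, - (h * inner ℝ P Q) ≤ θ' * ‖P‖^2 + 1 / (4 * θ') * ‖Q‖^2 := by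
    intro P Q
    have h1 := neg_le_of_abs_le (abs_real_inner_le_norm P Q)
    have h2 := aux_young ‖P‖ ‖Q‖ θ' hθ'
    have h3 : h * (- inner ℝ P Q) ≤ h * (‖P‖ * ‖Q‖) := mul_le_mul_of_nonneg_left (by linarith) hh0
    have h4 : h * (‖P‖ * ‖Q‖) ≤ ‖P‖ * ‖Q‖ := mul_le_of_le_one_left (by positivity) hh1
    have h5 : ‖Q‖^2 / (4 * θ') = 1 / (4 * θ') * ‖Q‖^2 := by ring
    linarith
  have a3 : -(hu * inner ℝ S U + hv * inner ℝ S V) ≤ θ * ‖S‖^2 + k / (4 * θ) * (‖U‖^2+‖V‖^2) := by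
    have h1 : ∀ (x : ℝ) (Q : E), -(x * inner ℝ S Q) ≤ |x| * (‖S‖ * ‖Q‖) := by
      intro x Q
      refine (neg_le_abs _).trans ?_
      rw [abs_mul]
      exact mul_le_mul_of_nonneg_left (abs_real_inner_le_norm S Q) (abs_nonneg _)
    have h2 := aux_young ‖S‖ (|hu| * ‖U‖ + |hv| * ‖V‖) θ hθ
    have h3 : (|hu| * ‖U‖ + |hv| * ‖V‖)^2 ≤ k * (‖U‖^2+‖V‖^2) := by
      have e1 := sq_abs hu
      have e2 := sq_abs hv
      have h4 : (|hu| * ‖U‖ + |hv| * ‖V‖)^2 ≤ (hu^2+hv^2) * (‖U‖^2+‖V‖^2) := by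
        rw [← e1, ← e2]
        nlinarith [sq_nonneg (|hu| * ‖V‖ - |hv| * ‖U‖)]
      exact h4.trans (mul_le_mul_of_nonneg_right hk (by positivity))
    have h5 : (|hu| * ‖U‖ + |hv| * ‖V‖)^2 / (4 * θ) ≤ k / (4 * θ) * (‖U‖^2+‖V‖^2) := by
      rw [div_mul_eq_mul_div]
      gcongr
    have := h1 hu U
    have := h1 hv V
    linarith
  have b1 := a2 Su U
  have b2 := a2 Sv V
  have hs2 : h * inner ℝ S lap1 + h * inner ℝ S lap2 = - (h * inner ℝ S d) + h * ‖S‖^2 := by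
    rw [← mul_add, hs]; ring
  linarith

end

/-- Lower bound for the Dirichlet energy of the torsion potential `𝒯` solving
`Δ𝒯 = -δ𝒯 + 𝒮` in `B`, `𝒯 = 0` on `∂B`, with
`|δ𝒯| ≤ √(n-2)|𝒯_u||𝒯_v|`, in terms of `‖𝒮‖_{L²(B_ρ)}`, `‖𝒮‖_{L²(B)}`,
`‖∇𝒮‖_{L²(B)}` and any `L^∞`-bound `M` of `𝒮` on `B`. -/
theorem total_torsion_lower_bound {n N : ℕ} (hN : N = n * (n - 1) / 2)
    (B Bρ : Set (ℝ × ℝ)) (ρ : ℝ) (hρ0 : 0 < ρ) (hρ1 : ρ < 1)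
    (hB : B = {p : ℝ × ℝ | p.1 ^ 2 + p.2 ^ 2 < 1})
    (hBρ : Bρ = {p : ℝ × ℝ | p.1 ^ 2 + p.2 ^ 2 < ρ ^ 2})
    (𝒯 δ𝒯 𝒮 : ℝ × ℝ → EuclideanSpace ℝ (Fin N))
    (hT : ContDiffOn ℝ 2 𝒯 B) (hTc : ContinuousOn 𝒯 (closure B))
    (hS : ContDiffOn ℝ 1 𝒮 (closure B))
    (hpde : ∀ w ∈ B,
      fderiv ℝ (fun p => fderiv ℝ 𝒯 p (1, 0)) w (1, 0)
        + fderiv ℝ (fun p => fderiv ℝ 𝒯 p (0, 1)) w (0, 1)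
      = -δ𝒯 w + 𝒮 w)
    (hbd : ∀ w : ℝ × ℝ, w.1 ^ 2 + w.2 ^ 2 = 1 → 𝒯 w = 0)
    (hδ : ∀ w ∈ B, ‖δ𝒯 w‖ ≤ Real.sqrt ((n : ℝ) - 2) *
      (‖fderiv ℝ 𝒯 w (1, 0)‖ * ‖fderiv ℝ 𝒯 w (0, 1)‖))
    (hSρ : 0 < ∫ w in Bρ, ‖𝒮 w‖ ^ 2)
    (hgradS : 0 < ∫ w in B,
      (‖fderiv ℝ 𝒮 w (1, 0)‖ ^ 2 + ‖fderiv ℝ 𝒮 w (0, 1)‖ ^ 2)) :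
    ∀ M : ℝ, (∀ w ∈ B, ‖𝒮 w‖ ≤ M) →
      ((∫ w in B, (‖fderiv ℝ 𝒯 w (1, 0)‖ ^ 2 + ‖fderiv ℝ 𝒯 w (0, 1)‖ ^ 2))
        ≥ (∫ w in Bρ, ‖𝒮 w‖ ^ 2) /
            (2 * (Real.sqrt ((n : ℝ) - 2) * M
              + (∫ w in B, ‖𝒮 w‖ ^ 2)
                  / ((1 - ρ) ^ 2 * ∫ w in Bρ, ‖𝒮 w‖ ^ 2)
              + 2 * (∫ w in B, (‖fderiv ℝ 𝒮 w (1, 0)‖ ^ 2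
                    + ‖fderiv ℝ 𝒮 w (0, 1)‖ ^ 2))
                  / ∫ w in Bρ, ‖𝒮 w‖ ^ 2)))
      ∧ 0 < (∫ w in Bρ, ‖𝒮 w‖ ^ 2) /
            (2 * (Real.sqrt ((n : ℝ) - 2) * M
              + (∫ w in B, ‖𝒮 w‖ ^ 2)
                  / ((1 - ρ) ^ 2 * ∫ w in Bρ, ‖𝒮 w‖ ^ 2)
              + 2 * (∫ w in B, (‖fderiv ℝ 𝒮 w (1, 0)‖ ^ 2
                    + ‖fderiv ℝ 𝒮 w (0, 1)‖ ^ 2))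
                  / ∫ w in Bρ, ‖𝒮 w‖ ^ 2)) := by
  subst_vars
  intro M hM
  set B : Set (ℝ × ℝ) := {p : ℝ × ℝ | p.1 ^ 2 + p.2 ^ 2 < 1} with hB
  set Bρ : Set (ℝ × ℝ) := {p : ℝ × ℝ | p.1 ^ 2 + p.2 ^ 2 < ρ ^ 2} with hBρ
  set L : ℝ := Real.sqrt ((n : ℝ) - 2) with hLdef
  have hL : 0 ≤ L := Real.sqrt_nonneg _
  have hX := aux_int L hL B hB 𝒯 δ𝒯 𝒮 hT hTc hS.continuousOn hpde hbd hδ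
  have hBo : IsOpen B := isOpen_lt (by fun_prop) (by fun_prop)
  have hBρo : IsOpen Bρ := isOpen_lt (by fun_prop) (by fun_prop)
  have hsub : Bρ ⊆ B := by
    intro w hw
    have hw : w.1^2+w.2^2 < ρ^2 := hw
    change w.1^2+w.2^2 < 1
    nlinarith
  have hfin : volume B < ⊤ := by
    refine (measure_mono (?_ : B ⊆ Metric.closedBall (0 : ℝ × ℝ) 1)).trans_lt
      measure_closedBall_lt_top
    intro w hw
    have : w.1^2+w.2^2 < 1 := hw
    rw [mem_closedBall_zero_iff, Prod.norm_def]
    refine max_le ?_ ?_ <;> rw [Real.norm_eq_abs, abs_le] <;> constructor <;> nlinarith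
  have hSc : ContDiffOn ℝ 1 𝒮 B := hS.mono subset_closure
  have hM0 : 0 ≤ M := (norm_nonneg _).trans (hM (0, 0) (by change (0:ℝ)^2+0^2 < 1; norm_num))
  have hSi : IntegrableOn (fun w => ‖𝒮 w‖^2) B := by
    refine Integrable.mono' (g := fun _ => M^2) (integrableOn_const hfin.ne)
      ((hSc.continuousOn.norm.pow 2).aestronglyMeasurable hBo.measurableSet) ?_
    refine ae_restrict_of_forall_mem hBo.measurableSet fun w hw => ?_
    rw [Real.norm_eq_abs, abs_of_nonneg (by positivity)]
    exact pow_le_pow_left₀ (norm_nonneg _) (hM w hw) 2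
  have hgi : IntegrableOn (fun w => ‖fderiv ℝ 𝒮 w (1, 0)‖ ^ 2 + ‖fderiv ℝ 𝒮 w (0, 1)‖ ^ 2) B := by
    by_contra h
    rw [integral_undef h] at hgradS
    exact lt_irrefl _ hgradS
  have hab : ∫ w in Bρ, ‖𝒮 w‖^2 ≤ ∫ w in B, ‖𝒮 w‖^2 :=
    setIntegral_mono_set hSi (Filter.Eventually.of_forall fun w => by positivity)
      (Filter.Eventually.of_forall hsub)
  refine aux_final _ _ _ _ (L * M) (1 - ρ) hSρ hab hgradS
    (integral_nonneg fun w => by positivity) (by positivity) (by linarith) ?_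
  intro θ θ' hθ hθ'
  obtain ⟨η, r, hηc, hr1, hr0, hη1, hηz, hη01, hηd⟩ := aux_cutoff ρ hρ0 hρ1
  set K : Set (ℝ × ℝ) := {p | p.1^2+p.2^2 ≤ r^2} with hK
  have hKB : K ⊆ B := by
    intro w hw
    have hw : w.1^2+w.2^2 ≤ r^2 := hw
    change w.1^2+w.2^2 < 1
    nlinarith
  have hKc : IsCompact K := by
    refine Metric.isCompact_of_isClosed_isBounded (isClosed_le (by fun_prop) (by fun_prop)) ?_
    refine (Metric.isBounded_closedBall (x := (0 : ℝ × ℝ)) (r := 1)).subset ?_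
    intro w hw
    have : w.1^2+w.2^2 < 1 := hKB hw
    rw [mem_closedBall_zero_iff, Prod.norm_def]
    refine max_le ?_ ?_ <;> rw [Real.norm_eq_abs, abs_le] <;> constructor <;> nlinarith
  have hUc : ∀ v : ℝ × ℝ, ContDiffOn ℝ 1 (fun p => fderiv ℝ 𝒯 p v) B := fun v =>
    (hT.fderiv_of_isOpen hBo (by norm_num)).clm_apply contDiffOn_const
  set F : ℝ × ℝ → ℝ × ℝ → ℝ := fun v p => η p * inner ℝ (𝒮 p) (fderiv ℝ 𝒯 p v) with hF
  have hFc : ∀ v, ContDiffOn ℝ 1 (F v) B := fun v => hηc.contDiffOn.mul (hSc.inner ℝ (hUc v))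
  have hFz : ∀ v, ∀ w ∈ B, w ∉ K → F v w = 0 := by
    intro v w hw hwK
    have : r^2 < w.1^2+w.2^2 := not_le.1 hwK
    simp [hF, hηz w this]
  obtain ⟨i1, z1⟩ := aux_div hBo (F (1,0)) (hFc _) K hKc hKB (hFz _) (1,0)
  obtain ⟨i2, z2⟩ := aux_div hBo (F (0,1)) (hFc _) K hKc hKB (hFz _) (0,1)
  set k : ℝ := (3/2) / (1-ρ)^2 with hk
  have hpt : ∀ w ∈ B, η w * ‖𝒮 w‖^2 ≤ fderiv ℝ (F (1,0)) w (1,0) + fderiv ℝ (F (0,1)) w (0,1)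
      + (θ * ‖𝒮 w‖^2 + k / (4 * θ) * (‖fderiv ℝ 𝒯 w (1, 0)‖ ^ 2 + ‖fderiv ℝ 𝒯 w (0, 1)‖ ^ 2)
        + θ' * (‖fderiv ℝ 𝒮 w (1, 0)‖ ^ 2 + ‖fderiv ℝ 𝒮 w (0, 1)‖ ^ 2)
        + 1 / (4 * θ') * (‖fderiv ℝ 𝒯 w (1, 0)‖ ^ 2 + ‖fderiv ℝ 𝒯 w (0, 1)‖ ^ 2)
        + L * M / 2 * (‖fderiv ℝ 𝒯 w (1, 0)‖ ^ 2 + ‖fderiv ℝ 𝒯 w (0, 1)‖ ^ 2)) := by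
    intro w hw
    have dS : DifferentiableAt ℝ 𝒮 w :=
      (hSc.contDiffAt (hBo.mem_nhds hw)).differentiableAt (by norm_num)
    have dU : ∀ v : ℝ × ℝ, DifferentiableAt ℝ (fun p => fderiv ℝ 𝒯 p v) w := fun v =>
      ((hUc v).contDiffAt (hBo.mem_nhds hw)).differentiableAt (by norm_num)
    have dη : DifferentiableAt ℝ η w := hηc.differentiable (by norm_num) w
    have p1 : fderiv ℝ (F (1,0)) w (1,0) = _ := aux_pt2 𝒮 _ η w (1,0) dS (dU (1,0)) dη
    have p2 : fderiv ℝ (F (0,1)) w (0,1) = _ := aux_pt2 𝒮 _ η w (0,1) dS (dU (0,1)) dη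
    rw [p1, p2]
    exact aux_alg L M θ θ' k (η w) _ _ (𝒮 w) _ _ _ _ (δ𝒯 w) _ _ hL hθ hθ' (hη01 w).1 (hη01 w).2
      (hηd w) (hM w hw) (hδ w hw) (hpde w hw)
  have hηi : IntegrableOn (fun w => η w * ‖𝒮 w‖^2) B := by
    refine hSi.mono' ((hηc.continuous.continuousOn.mul
      (hSc.continuousOn.norm.pow 2)).aestronglyMeasurable hBo.measurableSet) ?_
    refine Filter.Eventually.of_forall fun w => ?_
    rw [Real.norm_eq_abs, abs_of_nonneg (mul_nonneg (hη01 w).1 (by positivity))]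
    exact mul_le_of_le_one_left (by positivity) (hη01 w).2
  have hlow : ∫ w in Bρ, ‖𝒮 w‖^2 ≤ ∫ w in B, η w * ‖𝒮 w‖^2 := by
    have : ∫ w in Bρ, ‖𝒮 w‖^2 = ∫ w in Bρ, η w * ‖𝒮 w‖^2 := by
      refine setIntegral_congr_fun hBρo.measurableSet fun w hw => ?_
      simp [hη1 w hw]
    rw [this]
    exact setIntegral_mono_set hηi
      (Filter.Eventually.of_forall fun w => mul_nonneg (hη01 w).1 (by positivity))
      (Filter.Eventually.of_forall hsub)
  have j1 := hSi.const_mul θ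
  have j2 := hX.const_mul (k / (4 * θ))
  have j3 := hgi.const_mul θ'
  have j4 := hX.const_mul (1 / (4 * θ'))
  have j5 := hX.const_mul (L * M / 2)
  have k2 := j1.fun_add j2
  have k3 := k2.fun_add j3
  have k4 := k3.fun_add j4
  have k5 := k4.fun_add j5
  have l := Integrable.fun_add i1 i2
  have hup := setIntegral_mono_on hηi (l.fun_add k5) hBo.measurableSet hpt
  rw [integral_add l k5, integral_add i1 i2, z1, z2, integral_add k4 j5, integral_add k3 j4,
    integral_add k2 j3, integral_add j1 j2, integral_const_mul, integral_const_mul,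
    integral_const_mul, integral_const_mul, integral_const_mul] at hup
  refine hlow.trans (hup.trans (le_of_eq ?_))
  ring
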